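/- Let r = X → Y be a totally-ordered sequential rule over a sequence database D, and let r' be a ToSR obtained from r by a left I-expansion or a left S-expansion with an item i. Then u(r') ≤ LEPEU(r). -/

import Mathlib

open scoped Classical

noncomputable section

namespace TotalSR

variable {I : Type*} [LinearOrder I]

/-- A sequence: a list of itemsets. -/
abbrev Seqc (I : Type*) := List (Finset I)

/-- The set of items occurring in a sequence. -/
def itemsOf (s : Seqc I) : Finset I := s.foldr (· ∪ ·) ∅

/-- Well-formed sequence: nonempty, all itemsets nonempty, and each item
occurs at most once (itemsets pairwise disjoint). -/
def WFSeq (s : Seqc I) : Prop :=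
  s ≠ [] ∧ (∀ e ∈ s, e.Nonempty) ∧ s.Pairwise fun a b => Disjoint a b

/-- `s₁` occurs in `s₂` (written s₁ ⊑ s₂): there exist strictly increasing
indices matching each itemset of `s₁` into a superset itemset of `s₂`. -/
def OccursIn (s₁ s₂ : Seqc I) : Prop :=
  ∃ t : List (Finset I), t.Sublist s₂ ∧ List.Forall₂ (· ⊆ ·) s₁ t

/-- The rule X → Y occurs in s: there is a split position 1 ≤ k < |s|
with X occurring in the first k itemsets and Y in the remaining ones. -/
def RuleOccursIn (X Y s : Seqc I) : Prop :=
  ∃ k, 1 ≤ k ∧ k < s.length ∧ OccursIn X (s.take k) ∧ OccursIn Y (s.drop k)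

/-- seq(r): the sequences of the database D in which the rule X → Y occurs. -/
def seqL (D : List (Seqc I)) (X Y : Seqc I) : List (Seqc I) :=
  D.filter fun s => decide (RuleOccursIn X Y s)

/-- ant(r): the sequences of the database D in which the antecedent X occurs. -/
def antL (D : List (Seqc I)) (X : Seqc I) : List (Seqc I) :=
  D.filter fun s => decide (OccursIn X s)

/-- conf(r) = |seq(r)| / |ant(r)|. -/
def conf (D : List (Seqc I)) (X Y : Seqc I) : ℝ :=
  ((seqL D X Y).length : ℝ) / ((antL D X).length : ℝ)

variable (q : I → Seqc I → ℝ) (iu : I → ℝ)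

/-- u(i, s) = q(i, s) · iu(i). -/
def itemUtil (j : I) (s : Seqc I) : ℝ := q j s * iu j

/-- u(r, s): the sum of u(i, s) over all items occurring in X or Y. -/
def ruleUtilIn (X Y s : Seqc I) : ℝ :=
  ∑ j ∈ itemsOf X ∪ itemsOf Y, itemUtil q iu j s

/-- u(r) = Σ_{s ∈ seq(r)} u(r, s). -/
def ruleUtil (D : List (Seqc I)) (X Y : Seqc I) : ℝ :=
  ((seqL D X Y).map (ruleUtilIn q iu X Y)).sum

/-- I-extension of a sequence: insert item i into the last itemset. -/
def iExt (X : Seqc I) (i : I) : Seqc I := X.dropLast ++ [insert i (X.getLastD ∅)]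

/-- S-extension of a sequence: append the singleton itemset {i}. -/
def sExt (X : Seqc I) (i : I) : Seqc I := X ++ [{i}]

/-- X' is obtained from the rule X → Y by a left I- or S-expansion with item i. -/
def IsLeftExp (X Y : Seqc I) (i : I) (X' : Seqc I) : Prop :=
  i ∉ itemsOf Y ∧
    ((X' = iExt X i ∧ ∀ a ∈ X.getLastD ∅, a < i) ∨ X' = sExt X i)

/-- Y' is obtained from the rule X → Y by a right I- or S-expansion with item i. -/
def IsRightExp (X Y : Seqc I) (i : I) (Y' : Seqc I) : Prop :=
  i ∉ itemsOf X ∧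
    ((Y' = iExt Y i ∧ ∀ a ∈ Y.getLastD ∅, a < i) ∨ Y' = sExt Y i)

/-- ULeft(r, s): sum of u(j, s) over items j of s such that some left
expansion of r with j occurs in s. -/
def ULeft (X Y s : Seqc I) : ℝ :=
  ∑ j ∈ (itemsOf s).filter
      (fun j => ∃ X', IsLeftExp X Y j X' ∧ RuleOccursIn X' Y s),
    itemUtil q iu j s

/-- LEPEU(r, s). -/
def LEPEUs (X Y s : Seqc I) : ℝ :=
  if 0 < ULeft q iu X Y s then ruleUtilIn q iu X Y s + ULeft q iu X Y s else 0

/-- LEPEU(r) = Σ_{s ∈ seq(r)} LEPEU(r, s). -/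
def LEPEU (D : List (Seqc I)) (X Y : Seqc I) : ℝ :=
  ((seqL D X Y).map (LEPEUs q iu X Y)).sum

/-- URight(r, s): sum of u(j, s) over items j of s such that some right
expansion of r with j occurs in s. -/
def URight (X Y s : Seqc I) : ℝ :=
  ∑ j ∈ (itemsOf s).filter
      (fun j => ∃ Y', IsRightExp X Y j Y' ∧ RuleOccursIn X Y' s),
    itemUtil q iu j s

/-- REPEU(r, s). -/
def REPEUs (X Y s : Seqc I) : ℝ :=
  if 0 < URight q iu X Y s then ruleUtilIn q iu X Y s + URight q iu X Y s else 0

/-- REPEU(r) = Σ_{s ∈ seq(r)} REPEU(r, s). -/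
def REPEU (D : List (Seqc I)) (X Y : Seqc I) : ℝ :=
  ((seqL D X Y).map (REPEUs q iu X Y)).sum

/-- j occurs strictly after i in s: in a strictly later itemset, or in the
same itemset and strictly greater in the item order. -/
def AfterIn (s : Seqc I) (i j : I) : Prop :=
  ∃ a b : Fin s.length, i ∈ s.get a ∧ j ∈ s.get b ∧ (a < b ∨ (a = b ∧ i < j))

/-- UILeft(r, i, s): u(i, s) plus the sum of u(j, s) over items j of s
occurring strictly after i such that some left expansion of r with j occurs in s. -/
def UILeft (X Y : Seqc I) (i : I) (s : Seqc I) : ℝ :=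
  itemUtil q iu i s +
    ∑ j ∈ (itemsOf s).filter
        (fun j => AfterIn s i j ∧ ∃ X', IsLeftExp X Y j X' ∧ RuleOccursIn X' Y s),
      itemUtil q iu j s

/-- LERSPEU(r') = Σ_{s ∈ seq(r')} (u(r, s) + UILeft(r, i, s)), where r' = X⋄i → Y. -/
def LERSPEU (D : List (Seqc I)) (X Y : Seqc I) (i : I) (X' : Seqc I) : ℝ :=
  ((seqL D X' Y).map fun s => ruleUtilIn q iu X Y s + UILeft q iu X Y i s).sum

/-- UIRight(r, i, s): u(i, s) plus the sum of u(j, s) over items j of s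
occurring strictly after i in s. -/
def UIRight (i : I) (s : Seqc I) : ℝ :=
  itemUtil q iu i s +
    ∑ j ∈ (itemsOf s).filter (fun j => AfterIn s i j), itemUtil q iu j s

/-- RERSPEU(r') = Σ_{s ∈ seq(r')} (u(r, s) + UIRight(r, i, s)), where r' = X → Y⋄i. -/
def RERSPEU (D : List (Seqc I)) (X Y : Seqc I) (i : I) (Y' : Seqc I) : ℝ :=
  ((seqL D X Y').map fun s => ruleUtilIn q iu X Y s + UIRight q iu i s).sum

/-- The total utility of all items occurring in a sequence. -/
def totalUtil (s : Seqc I) : ℝ := ∑ j ∈ itemsOf s, itemUtil q iu j s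

/-- SEU(i): sum, over the sequences of D in which item i occurs, of the
total utility of the sequence. -/
def SEUitem (D : List (Seqc I)) (i : I) : ℝ :=
  ((D.filter fun s => decide (i ∈ itemsOf s)).map (totalUtil q iu)).sum

/-- SEU(r): sum, over the sequences of D in which the rule r occurs, of the
total utility of the sequence. -/
def SEUrule (D : List (Seqc I)) (X Y : Seqc I) : ℝ :=
  ((seqL D X Y).map (totalUtil q iu)).sum

/-- One expansion step on rules (as pairs (antecedent, consequent)):
either a left I- or S-expansion or a right I- or S-expansion with some item. -/
def ExpStep (p p' : Seqc I × Seqc I) : Prop :=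
  (∃ i, IsLeftExp p.1 p.2 i p'.1 ∧ p'.2 = p.2) ∨
    (∃ i, IsRightExp p.1 p.2 i p'.2 ∧ p'.1 = p.1)

lemma mem_itemsOf {s : Seqc I} {j : I} : j ∈ itemsOf s ↔ ∃ e ∈ s, j ∈ e := by
  induction s with
  | nil => simp [itemsOf]
  | cons a s ih =>
    have h : itemsOf (a :: s) = a ∪ itemsOf s := rfl
    simp [h, ih]

lemma occursIn_iff_sublistForall₂ {s t : Seqc I} :
    OccursIn s t ↔ List.SublistForall₂ (· ⊆ ·) s t := by
  rw [List.sublistForall₂_iff]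
  exact exists_congr fun _ => and_comm

lemma OccursIn.trans {s t u : Seqc I} (hst : OccursIn s t) (htu : OccursIn t u) :
    OccursIn s u := by
  rw [occursIn_iff_sublistForall₂] at *
  exact _root_.trans hst htu

lemma OccursIn.of_sublist {s t : Seqc I} (h : s.Sublist t) : OccursIn s t :=
  ⟨s, h, List.forall₂_refl s⟩

lemma OccursIn.itemsOf_subset {s t : Seqc I} (h : OccursIn s t) : itemsOf s ⊆ itemsOf t := by
  intro j hj
  obtain ⟨l, hl, hsl⟩ := h
  obtain ⟨e, he, hje⟩ := mem_itemsOf.1 hj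
  obtain ⟨k, hk, rfl⟩ := List.getElem_of_mem he
  have hk' : k < l.length := hsl.length_eq ▸ hk
  exact mem_itemsOf.2 ⟨l[k], hl.subset (List.getElem_mem hk'), hsl.get hk hk' hje⟩

lemma RuleOccursIn.itemsOf_union_subset {X Y s : Seqc I} (h : RuleOccursIn X Y s) :
    itemsOf X ∪ itemsOf Y ⊆ itemsOf s := by
  obtain ⟨k, -, -, hX, hY⟩ := h
  exact Finset.union_subset
    (hX.trans (.of_sublist (List.take_sublist k s))).itemsOf_subset
    (hY.trans (.of_sublist (List.drop_sublist k s))).itemsOf_subset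

lemma RuleOccursIn.of_occursIn {X X' Y s : Seqc I} (hX : OccursIn X X')
    (h : RuleOccursIn X' Y s) : RuleOccursIn X Y s := by
  obtain ⟨k, hk, hks, hX', hY⟩ := h
  exact ⟨k, hk, hks, hX.trans hX', hY⟩

lemma occursIn_iExt {X : Seqc I} (hX : X ≠ []) (i : I) : OccursIn X (iExt X i) := by
  refine ⟨iExt X i, List.Sublist.refl _, ?_⟩
  obtain ⟨L, a, rfl⟩ := List.eq_nil_or_concat X |>.resolve_left hX
  simp only [iExt, List.concat_eq_append, List.dropLast_concat, List.getLastD_concat]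
  exact List.rel_append (List.forall₂_refl L) (.cons (Finset.subset_insert i a) .nil)

lemma itemsOf_iExt {X : Seqc I} (hX : X ≠ []) (i : I) :
    itemsOf (iExt X i) = insert i (itemsOf X) := by
  obtain ⟨L, a, rfl⟩ := List.eq_nil_or_concat X |>.resolve_left hX
  ext j
  simp only [iExt, List.concat_eq_append, List.dropLast_concat, List.getLastD_concat,
    mem_itemsOf, List.mem_append, List.mem_singleton, Finset.mem_insert]
  grind

lemma itemsOf_sExt (X : Seqc I) (i : I) : itemsOf (sExt X i) = insert i (itemsOf X) := by
  ext j
  simp only [sExt, mem_itemsOf, List.mem_append, List.mem_singleton, Finset.mem_insert]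
  grind

lemma IsLeftExp.occursIn {X Y X' : Seqc I} {i : I} (hX : X ≠ []) (h : IsLeftExp X Y i X') :
    OccursIn X X' := by
  obtain ⟨-, ⟨rfl, -⟩ | rfl⟩ := h
  · exact occursIn_iExt hX i
  · exact .of_sublist (List.sublist_append_left X _)

lemma IsLeftExp.itemsOf_eq {X Y X' : Seqc I} {i : I} (hX : X ≠ []) (h : IsLeftExp X Y i X') :
    itemsOf X' = insert i (itemsOf X) := by
  obtain ⟨-, ⟨rfl, -⟩ | rfl⟩ := h
  · exact itemsOf_iExt hX i
  · exact itemsOf_sExt X i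

lemma LEPEUs_nonneg {X Y s : Seqc I} (hs : ∀ j ∈ itemsOf s, 0 < itemUtil q iu j s)
    (h : RuleOccursIn X Y s) : 0 ≤ LEPEUs q iu X Y s := by
  unfold LEPEUs
  split_ifs with hU
  · exact add_nonneg
      (Finset.sum_nonneg fun j hj => (hs j (h.itemsOf_union_subset hj)).le) hU.le
  · exact le_rfl

lemma ruleUtilIn_le_LEPEUs {X Y X' s : Seqc I} {i : I} (hX : X ≠ [])
    (hs : ∀ j ∈ itemsOf s, 0 < itemUtil q iu j s) (hexp : IsLeftExp X Y i X')
    (h : RuleOccursIn X' Y s) : ruleUtilIn q iu X' Y s ≤ LEPEUs q iu X Y s := by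
  have hitems : itemsOf X' ∪ itemsOf Y = insert i (itemsOf X ∪ itemsOf Y) := by
    rw [hexp.itemsOf_eq hX, Finset.insert_union]
  have hi : i ∈ itemsOf s :=
    h.itemsOf_union_subset (hitems ▸ Finset.mem_insert_self i _)
  have hiU : itemUtil q iu i s ≤ ULeft q iu X Y s :=
    Finset.single_le_sum (f := fun j => itemUtil q iu j s)
      (fun j hj => (hs j (Finset.mem_filter.1 hj).1).le)
      (Finset.mem_filter.2 ⟨hi, X', hexp, h⟩)
  have hle : ruleUtilIn q iu X' Y s ≤ ruleUtilIn q iu X Y s + itemUtil q iu i s := by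
    unfold ruleUtilIn
    rw [hitems]
    by_cases hmem : i ∈ itemsOf X ∪ itemsOf Y
    · rw [Finset.insert_eq_of_mem hmem]
      linarith [hs i hi]
    · rw [Finset.sum_insert hmem, add_comm]
  rw [LEPEUs, if_pos ((hs i hi).trans_le hiU)]
  linarith

/-- if r' is obtained from r = X → Y by a left I- or S-expansion
with item i, then u(r') ≤ LEPEU(r). -/
theorem utility_le_LEPEU_of_leftExp
    (hiu : ∀ j : I, 0 < iu j)
    (hq : ∀ (j : I) (s : Seqc I), j ∈ itemsOf s → 0 < q j s)
    (D : List (Seqc I)) (hD : ∀ s ∈ D, WFSeq s)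
    (X Y : Seqc I) (hX : WFSeq X) (hY : WFSeq Y)
    (hXY : Disjoint (itemsOf X) (itemsOf Y))
    (i : I) (X' : Seqc I) (hexp : IsLeftExp X Y i X')
    (hX' : WFSeq X') (hX'Y : Disjoint (itemsOf X') (itemsOf Y)) :
    ruleUtil q iu D X' Y ≤ LEPEU q iu D X Y := by
  have hpos : ∀ s : Seqc I, ∀ j ∈ itemsOf s, 0 < itemUtil q iu j s :=
    fun s j hj => mul_pos (hq j s hj) (hiu j)
  clear hD
  unfold ruleUtil LEPEU seqL
  induction D with
  | nil => simp
  | cons s D ih =>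
    by_cases h' : RuleOccursIn X' Y s
    · have h := h'.of_occursIn (hexp.occursIn hX.1)
      simpa [List.filter_cons, h, h'] using
        add_le_add (ruleUtilIn_le_LEPEUs q iu hX.1 (hpos s) hexp h') ih
    · by_cases h : RuleOccursIn X Y s
      · simpa [List.filter_cons, h, h'] using
          add_le_add (LEPEUs_nonneg q iu (hpos s) h) ih
      · simpa [List.filter_cons, h, h'] using ih

end TotalSR
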